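/- Let π = (π_i)_{i≥0} be a probability distribution on the nonnegative integers with Σ_k k²π_k < ∞, π_0 < 1, whose generating function f_π satisfies f_π″(1) > f_π′(1). Define f(t,s) = f_π( f_π⁻¹(1−t) − (1−s)·f_π′(f_π⁻¹(1−t))/f_π′(1) ) for 0 ≤ t ≤ t′_max and 0 ≤ s ≤ 1. Then f satisfies the partial differential equation ∂f/∂t (t,s) = ( ∂f/∂s (t,s) / ∂f/∂s (t,1) ) · ( (1−s)·(∂²f/∂s² (t,1)) / (∂f/∂s (t,1)) − 1 ) for all t ∈ (0, t′_max) and s ∈ [0,1]. -/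

import Mathlib

open Set

open Filter Topology

/-- A function vanishing on `(a, ∞)` but not at `a` has zero (junk) first and second derivative
at `a`. -/
theorem deriv_eq_zero_and_iteratedDeriv_two_eq_zero_of_jump {f : ℝ → ℝ} {a : ℝ}
    (hz : ∀ s, a < s → f s = 0) (ha : f a ≠ 0) :
    deriv f a = 0 ∧ iteratedDeriv 2 f a = 0 := by
  have h1 : deriv f a = 0 := by
    refine deriv_zero_of_not_differentiableAt fun hd => ha ?_
    have h := hd.continuousAt.tendsto.mono_left (nhdsWithin_le_nhds (s := Ioi a))
    refine tendsto_nhds_unique h (tendsto_const_nhds.congr' ?_)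
    filter_upwards [self_mem_nhdsWithin] with s hs
    exact (hz s hs).symm
  refine ⟨h1, ?_⟩
  have h2 : ∀ s ∈ Ici a, deriv f s = 0 := by
    intro s hs
    rcases eq_or_lt_of_le (mem_Ici.1 hs) with h | h
    · rw [← h, h1]
    · have : f =ᶠ[𝓝 s] fun _ => 0 := by
        filter_upwards [Ioi_mem_nhds h] with y hy using hz y hy
      rw [this.deriv_eq, deriv_const]
  rw [iteratedDeriv_succ, iteratedDeriv_one]
  by_cases hd : DifferentiableAt ℝ (deriv f) a
  · have h3 : HasDerivWithinAt (deriv f) 0 (Ici a) a :=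
      (hasDerivWithinAt_const a (Ici a) (0 : ℝ)).congr h2 h1
    exact (uniqueDiffOn_Ici a a self_mem_Ici).eq_deriv _ hd.hasDerivAt.hasDerivWithinAt h3
  · exact deriv_zero_of_not_differentiableAt hd

theorem summable_mul_pow_of_abs_le {a : ℕ → ℝ} (ha : ∀ i, 0 ≤ a i) {r s : ℝ}
    (hs : |s| ≤ r) (hr : Summable fun i => a i * r ^ i) : Summable fun i => a i * s ^ i := by
  refine Summable.of_norm_bounded hr fun i => ?_
  rw [norm_mul, norm_pow, Real.norm_eq_abs, Real.norm_eq_abs, abs_of_nonneg (ha i)]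
  have := ha i
  gcongr

theorem analyticAt_tsum_mul_pow {a : ℕ → ℝ} {r s : ℝ} (ha : ∀ i, 0 ≤ a i) (hs : |s| < r)
    (hr : Summable fun i => a i * r ^ i) : AnalyticAt ℝ (fun s => ∑' i, a i * s ^ i) s := by
  have hr0 : 0 < r := (abs_nonneg s).trans_lt hs
  let p := FormalMultilinearSeries.ofScalars ℝ a
  have hrad : (r.toNNReal : ENNReal) ≤ p.radius := by
    refine p.le_radius_of_summable (hr.congr fun i => ?_)
    rw [FormalMultilinearSeries.ofScalars_norm, Real.coe_toNNReal _ hr0.le, Real.norm_eq_abs,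
      abs_of_nonneg (ha i)]
  have hpos : 0 < p.radius := lt_of_lt_of_le (by simpa using hr0) hrad
  have hb := p.hasFPowerSeriesOnBall hpos
  have hfun : p.sum = fun s => ∑' i, a i * s ^ i := by
    ext y
    simp [p, FormalMultilinearSeries.sum, mul_comm]
  rw [← hfun]
  refine hb.analyticAt_of_mem (Metric.eball_subset_eball hrad ?_)
  rw [Metric.mem_eball, edist_zero_right, ← ofReal_norm, Real.norm_eq_abs]
  exact (ENNReal.ofReal_lt_ofReal_iff hr0).2 hs

theorem convexOn_tsum_mul_pow {a : ℕ → ℝ} {r : ℝ} (ha : ∀ i, 0 ≤ a i)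
    (hr : Summable fun i => a i * r ^ i) :
    ConvexOn ℝ (Icc 0 r) (fun s => ∑' i, a i * s ^ i) := by
  have hsum : ∀ s ∈ Icc 0 r, Summable fun i => a i * s ^ i := fun s hs =>
    summable_mul_pow_of_abs_le ha (by rw [abs_of_nonneg hs.1]; exact hs.2) hr
  refine ⟨convex_Icc 0 r, fun x hx y hy b c hb hc hbc => ?_⟩
  have hm := convex_Icc 0 r hx hy hb hc hbc
  simp only [smul_eq_mul] at hm ⊢
  rw [← tsum_mul_left, ← tsum_mul_left, ← ((hsum x hx).mul_left b).tsum_add ((hsum y hy).mul_left c)]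
  refine (hsum _ hm).tsum_le_tsum (fun i => ?_)
    (((hsum x hx).mul_left b).add ((hsum y hy).mul_left c))
  have h := (convexOn_pow (𝕜 := ℝ) i).2 hx.1 hy.1 hb hc hbc
  simp only [smul_eq_mul] at h
  nlinarith [mul_le_mul_of_nonneg_left h (ha i)]

/-- The explicit function `f(t,s) = f_π(f_π⁻¹(1-t) - (1-s) f_π'(f_π⁻¹(1-t)) / f_π'(1))`
satisfies the partial differential equation
`∂f/∂t (t,s) = (∂f/∂s (t,s) / ∂f/∂s (t,1)) · ((1-s) ∂²f/∂s² (t,1) / ∂f/∂s (t,1) - 1)`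
for `t ∈ (0, t'max)` and `s ∈ [0,1]`. -/
theorem explicit_generating_series_PDE
    (π : ℕ → ℝ) (hπ0 : ∀ i, 0 ≤ π i) (hπ1 : ∑' i : ℕ, π i = 1)
    (hmom : Summable fun k : ℕ => (k : ℝ) ^ 2 * π k) (hπ0lt : π 0 < 1)
    (fπ : ℝ → ℝ) (hfπ : ∀ s, fπ s = ∑' i : ℕ, π i * s ^ i)
    (hsup : iteratedDeriv 2 fπ 1 > deriv fπ 1)
    (finv : ℝ → ℝ)
    (hleft : ∀ x ∈ Icc (0 : ℝ) 1, finv (fπ x) = x)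
    (hright : ∀ y ∈ Icc (π 0) 1, finv y ∈ Icc (0 : ℝ) 1 ∧ fπ (finv y) = y)
    (tmax' : ℝ) (htm : tmax' ∈ Ioo (0 : ℝ) (1 - π 0))
    (hroot : iteratedDeriv 2 fπ (finv (1 - tmax')) = deriv fπ 1)
    (huniq : ∀ t ∈ Ioo (0 : ℝ) (1 - π 0),
      iteratedDeriv 2 fπ (finv (1 - t)) = deriv fπ 1 → t = tmax')
    (F : ℝ → ℝ → ℝ)
    (hF : ∀ t s, F t s = fπ (finv (1 - t) - (1 - s) * deriv fπ (finv (1 - t)) / deriv fπ 1)) :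
    ∀ t ∈ Ioo (0 : ℝ) tmax', ∀ s ∈ Icc (0 : ℝ) 1,
      deriv (fun u => F u s) t
        = (deriv (fun v => F t v) s / deriv (fun v => F t v) 1)
          * ((1 - s) * iteratedDeriv 2 (fun v => F t v) 1 / deriv (fun v => F t v) 1 - 1) := by
  intro t ht s hs
  have hs1 : Summable π := by
    by_contra h
    rw [tsum_eq_zero_of_not_summable h] at hπ1
    exact zero_ne_one hπ1
  have hf1 : fπ 1 = 1 := by rw [hfπ]; simpa using hπ1
  have hf0 : fπ 0 = π 0 := by
    rw [hfπ, tsum_eq_single 0 (fun i hi => by simp [hi])]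
    simp
  obtain ⟨r, hr1, hr⟩ : ∃ r > 1, Summable fun i => π i * r ^ i := by
    by_contra! h
    obtain ⟨h1, h2⟩ := deriv_eq_zero_and_iteratedDeriv_two_eq_zero_of_jump (f := fπ) (a := 1)
      (fun s hs => by rw [hfπ, tsum_eq_zero_of_not_summable (h s hs)]) (by simp [hf1])
    rw [h1, h2] at hsup
    exact lt_irrefl _ hsup
  have hfun : fπ = fun s => ∑' i, π i * s ^ i := funext hfπ
  have han : ∀ y, |y| < r → AnalyticAt ℝ fπ y := fun y hy => by
    rw [hfun]
    exact analyticAt_tsum_mul_pow hπ0 hy hr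
  have hconv : ConvexOn ℝ (Icc 0 r) fπ := by
    rw [hfun]
    exact convexOn_tsum_mul_pow hπ0 hr
  obtain ⟨hx, hfx⟩ := hright (1 - t) ⟨by linarith [ht.2, htm.2], by linarith [ht.1]⟩
  set x := finv (1 - t) with hxdef
  have hx0 : 0 < x := lt_of_le_of_ne hx.1 fun h => by
    rw [← h, hf0] at hfx
    linarith [ht.2, htm.2]
  have hx1 : x < 1 := lt_of_le_of_ne hx.2 fun h => by
    rw [h, hf1] at hfx
    linarith [ht.1]
  have hxr : |x| < r := by rw [abs_of_pos hx0]; linarith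
  have hd : ∀ y, |y| < r → HasDerivAt fπ (deriv fπ y) y := fun y hy =>
    (han y hy).differentiableAt.hasDerivAt
  have hdd : HasDerivAt (deriv fπ) (iteratedDeriv 2 fπ x) x := by
    rw [iteratedDeriv_succ, iteratedDeriv_one]
    exact (han x hxr).deriv.differentiableAt.hasDerivAt
  have hdx : 0 < deriv fπ x := by
    have h := hconv.slope_le_deriv ⟨le_rfl, by linarith⟩ ⟨hx0.le, by linarith⟩ hx0
      (han x hxr).differentiableAt
    refine lt_of_lt_of_le ?_ h
    rw [slope_def_field, hfx, hf0]
    exact div_pos (by linarith [ht.2, htm.2]) (by linarith)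
  have h1r : |(1 : ℝ)| < r := by rwa [abs_one]
  have hle : deriv fπ x ≤ deriv fπ 1 :=
    (hconv.deriv_le_slope ⟨hx0.le, by linarith⟩ ⟨zero_le_one, hr1.le⟩ hx1
      (han x hxr).differentiableAt).trans
    (hconv.slope_le_deriv ⟨hx0.le, by linarith⟩ ⟨zero_le_one, hr1.le⟩ hx1
      (han 1 h1r).differentiableAt)
  have hm : 0 < deriv fπ 1 := hdx.trans_le hle
  set m := deriv fπ 1 with hmdef
  set d := deriv fπ x with hddef
  have harg : ∀ v ∈ Icc (0 : ℝ) 1, |x - (1 - v) * d / m| < r := by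
    intro v hv
    have h0 : 0 ≤ (1 - v) * d / m :=
      div_nonneg (mul_nonneg (by linarith [hv.2]) hdx.le) hm.le
    have h1 : (1 - v) * d / m ≤ 1 := by
      rw [div_le_one hm]
      nlinarith [hv.1]
    rw [abs_lt]
    constructor <;> linarith
  have hinner : ∀ v, HasDerivAt (fun v => x - (1 - v) * d / m) (d / m) v := fun v => by
    have h := ((((hasDerivAt_id v).const_sub 1).mul_const d).div_const m).const_sub x
    refine h.congr_deriv ?_
    ring
  have hFs : ∀ v ∈ Icc (0 : ℝ) 1,
      ∀ᶠ v in 𝓝 v, HasDerivAt (fun v => F t v) (deriv fπ (x - (1 - v) * d / m) * (d / m)) v := by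
    intro v hv
    have hev : ∀ᶠ w in 𝓝 v, |x - (1 - w) * d / m| < r :=
      (hinner v).continuousAt.abs.eventually (Iio_mem_nhds (harg v hv))
    filter_upwards [hev] with w hw
    simp only [hF]
    exact (hd _ hw).comp w (hinner w)
  have h1mem : (1 : ℝ) ∈ Icc (0 : ℝ) 1 := ⟨zero_le_one, le_rfl⟩
  have hx11 : x - (1 - 1) * d / m = x := by ring
  have hFs1 : deriv (fun v => F t v) 1 = d * (d / m) := by
    rw [(hFs 1 h1mem).self_of_nhds.deriv, hx11]
  have hFss : iteratedDeriv 2 (fun v => F t v) 1 = iteratedDeriv 2 fπ x * (d / m) * (d / m) := by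
    have heq : deriv (fun v => F t v) =ᶠ[𝓝 1]
        fun v => deriv fπ (x - (1 - v) * d / m) * (d / m) :=
      (hFs 1 h1mem).mono fun v hv => hv.deriv
    rw [iteratedDeriv_succ (n := 1) (f := fun v => F t v), iteratedDeriv_one, heq.deriv_eq]
    have hc : HasDerivAt (fun v => deriv fπ (x - (1 - v) * d / m))
        (iteratedDeriv 2 fπ x * (d / m)) 1 :=
      HasDerivAt.comp (h₂ := deriv fπ) 1 (by rw [hx11]; exact hdd) (hinner 1)
    exact (hc.mul_const (d / m)).deriv
  have hX : HasDerivAt (fun u => finv (1 - u)) (-d⁻¹) t := by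
    have hst : HasStrictDerivAt fπ d x := (han x hxr).hasStrictDerivAt
    have hinv : HasDerivAt finv d⁻¹ (1 - t) := by
      rw [← hfx]
      refine (hst.to_local_left_inverse hdx.ne' ?_).hasDerivAt
      filter_upwards [Icc_mem_nhds hx0 hx1] with y hy using hleft y hy
    have h := HasDerivAt.comp t hinv ((hasDerivAt_id t).const_sub 1)
    exact h.congr_deriv (by ring)
  have hFt : HasDerivAt (fun u => F u s)
      (deriv fπ (x - (1 - s) * d / m) *
        (-d⁻¹ - (1 - s) * (iteratedDeriv 2 fπ x * -d⁻¹) / m)) t := by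
    have hdX : HasDerivAt (fun u => deriv fπ (finv (1 - u))) (iteratedDeriv 2 fπ x * -d⁻¹) t :=
      HasDerivAt.comp (h₂ := deriv fπ) t hdd hX
    have hin := hX.sub ((hdX.const_mul (1 - s)).div_const m)
    simp only [hF]
    exact HasDerivAt.comp (h₂ := fπ) t (hd _ (harg s hs)) hin
  rw [hFt.deriv, hFs1, hFss, (hFs s hs).self_of_nhds.deriv]
  field_simp
  ring
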